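/- arXiv:1001.0875 — 2 statements merged into one kernel-verified Lean document; each statement's English description precedes it below -/
import Mathlib

section
/- Let μ be a compactly-supported Borel probability measure on ℝⁿ whose support is not contained in a hyperplane. Suppose x₀ is an exposed point of the support of μ, i.e., there exists ξ ∈ ℝⁿ such that ξ·x₀ > ξ·x for all x ∈ Supp(μ) with x ≠ x₀. Then lim_{r → ∞} ∇Λ_μ(rξ) = x₀. -/
open MeasureTheory Real Set Filter Topology RealInnerProductSpace
noncomputable section

abbrev EucSp (n : ℕ) := EuclideanSpace ℝ (Fin n)

/-- The support of a Borel measure: the minimal closed set of full measure,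
i.e. the set of points all of whose neighborhoods have positive measure. -/
def msupport {n : ℕ} (μ : Measure (EucSp n)) : Set (EucSp n) :=
  {x | ∀ U ∈ nhds x, μ U ≠ 0}

/-- μ is compactly supported. -/
def IsCompactlySupported {n : ℕ} (μ : Measure (EucSp n)) : Prop :=
  ∃ K : Set (EucSp n), IsCompact K ∧ μ Kᶜ = 0

/-- The support of μ is not contained in a hyperplane (an affine hyperplane). -/
def SuppNotInHyperplane {n : ℕ} (μ : Measure (EucSp n)) : Prop :=
  ¬ ∃ (θ : EucSp n) (c : ℝ), θ ≠ 0 ∧ msupport μ ⊆ {x | ⟪θ, x⟫ = c}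

/-- The logarithmic Laplace transform Λ_μ(ξ) = log ∫ exp(ξ·x) dμ(x). -/
def logLaplace {n : ℕ} (μ : Measure (EucSp n)) (ξ : EucSp n) : ℝ :=
  Real.log (∫ x, Real.exp ⟪ξ, x⟫ ∂μ)

/-- The Hessian matrix of a function f : ℝⁿ → ℝ at a point ξ. -/
def hessianM {n : ℕ} (f : EucSp n → ℝ) (ξ : EucSp n) : Matrix (Fin n) (Fin n) ℝ :=
  Matrix.of fun i j =>
    fderiv ℝ (fun η => fderiv ℝ f η (EuclideanSpace.single j 1)) ξ
      (EuclideanSpace.single i 1)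

/-- Ψ_μ(ξ) = log ( det ∇²Λ_μ(ξ) / det ∇²Λ_μ(0) ). -/
def PsiFn {n : ℕ} (μ : Measure (EucSp n)) (ξ : EucSp n) : ℝ :=
  Real.log ((hessianM (logLaplace μ) ξ).det / (hessianM (logLaplace μ) 0).det)

theorem msupport_eq_support {n : ℕ} (μ : Measure (EucSp n)) : msupport μ = μ.support := by
  ext x
  simp only [msupport, Set.mem_ofPred_eq, Measure.mem_support_iff_forall, pos_iff_ne_zero]

theorem isCompact_msupport {n : ℕ} {μ : Measure (EucSp n)} (hμ : IsCompactlySupported μ) :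
    IsCompact (msupport μ) := by
  obtain ⟨K, hK, hK0⟩ := hμ
  refine hK.of_isClosed_subset (msupport_eq_support μ ▸ Measure.isClosed_support) fun x hx => ?_
  by_contra hxK
  exact hx Kᶜ (hK.isClosed.isOpen_compl.mem_nhds hxK) hK0

theorem ae_mem_msupport {n : ℕ} (μ : Measure (EucSp n)) : ∀ᵐ x ∂μ, x ∈ msupport μ :=
  msupport_eq_support μ ▸ Measure.support_mem_ae

/-- Laplace's principle: if `f` has a unique maximum `x₀` on a compact set `s`, the probability
measures with density proportional to `exp (r * f)` on `s` concentrate at `x₀` as `r → ∞`. -/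
theorem tendsto_setIntegral_exp_mul_smul_of_unique_maximum {α E : Type*} [MeasurableSpace α]
    [TopologicalSpace α] [BorelSpace α] [T2Space α] {μ : Measure α} [IsFiniteMeasure μ]
    [NormedAddCommGroup E] [NormedSpace ℝ E] [CompleteSpace E] {s : Set α} (hs : IsCompact s)
    {x₀ : α} (h₀ : x₀ ∈ s) (hμ : ∀ u, IsOpen u → x₀ ∈ u → 0 < μ (u ∩ s)) {f : α → ℝ}
    (hf : ContinuousOn f s) (hfmax : ∀ y ∈ s, y ≠ x₀ → f y < f x₀) {g : α → E}
    (hmg : IntegrableOn g s μ) (hcg : ContinuousWithinAt g s x₀) :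
    Tendsto (fun r : ℝ => (∫ x in s, rexp (r * f x) ∂μ)⁻¹ • ∫ x in s, rexp (r * f x) • g x ∂μ)
      atTop (𝓝 (g x₀)) := by
  have hcont (r : ℝ) : ContinuousOn (fun x => rexp (r * f x)) s := by fun_prop
  have hsm := hs.measurableSet
  have I (r : ℝ) : IntegrableOn (fun x => rexp (r * f x)) s μ := by
    obtain ⟨C, hC⟩ := hs.exists_bound_of_continuousOn (hcont r)
    exact Integrable.of_bound ((hcont r).aestronglyMeasurable_of_isCompact hs hsm) C
      ((ae_restrict_mem hsm).mono hC)
  have hμs : μ.restrict s ≠ 0 := by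
    rw [Ne, Measure.restrict_eq_zero]
    simpa using (hμ univ isOpen_univ trivial).ne'
  have : NeZero (μ.restrict s) := ⟨hμs⟩
  have P (r : ℝ) : 0 < ∫ x in s, rexp (r * f x) ∂μ := integral_exp_pos (I r)
  let φ : ℝ → α → ℝ := fun r x => (∫ x in s, rexp (r * f x) ∂μ)⁻¹ * rexp (r * f x)
  have hφ0 (r : ℝ) (x : α) : 0 ≤ φ r x := mul_nonneg (inv_nonneg.2 (P r).le) (exp_pos _).le
  have hφ1 (r : ℝ) : ∫ x in s, φ r x ∂μ = 1 := by
    rw [integral_const_mul, inv_mul_cancel₀ (P r).ne']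
  have A : ∀ u : Set α, IsOpen u → x₀ ∈ u → TendstoUniformlyOn φ 0 atTop (s \ u) := by
    intro u u_open x₀u
    obtain ⟨t, tx₀, ht⟩ : ∃ t, t < f x₀ ∧ ∀ x ∈ s \ u, f x ≤ t := by
      rcases eq_empty_or_nonempty (s \ u) with h | h
      · exact ⟨f x₀ - 1, by linarith, by simp [h]⟩
      obtain ⟨x, hx, h'x⟩ : ∃ x ∈ s \ u, ∀ y ∈ s \ u, f y ≤ f x :=
        IsCompact.exists_isMaxOn (hs.diff u_open) h (hf.mono sdiff_subset)
      exact ⟨f x, hfmax x hx.1 fun h => hx.2 (h ▸ x₀u), h'x⟩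
    obtain ⟨t', tt', t'x₀⟩ := exists_between tx₀
    obtain ⟨v, v_open, x₀_v, hv⟩ : ∃ v : Set α, IsOpen v ∧ x₀ ∈ v ∧ v ∩ s ⊆ f ⁻¹' Ioi t' :=
      _root_.continuousOn_iff.1 hf x₀ h₀ (Ioi t') isOpen_Ioi t'x₀
    have hvpos : 0 < μ.real (v ∩ s) :=
      ENNReal.toReal_pos (hμ v v_open x₀_v).ne' (measure_ne_top _ _)
    have hZ (r : ℝ) (hr : 0 ≤ r) :
        μ.real (v ∩ s) * rexp (r * t') ≤ ∫ x in s, rexp (r * f x) ∂μ := by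
      calc μ.real (v ∩ s) * rexp (r * t') = ∫ x in v ∩ s, rexp (r * t') ∂μ := by simp
        _ ≤ ∫ x in v ∩ s, rexp (r * f x) ∂μ := by
          refine setIntegral_mono_on integrableOn_const ((I r).mono_set inter_subset_right)
            (v_open.measurableSet.inter hsm) fun x hx => ?_
          have : t' < f x := hv hx
          gcongr
        _ ≤ ∫ x in s, rexp (r * f x) ∂μ :=
          setIntegral_mono_set (I r) (ae_of_all _ fun x => (exp_pos _).le)
            (ae_of_all _ fun x hx => hx.2)
    have M (r : ℝ) (hr : 0 ≤ r) (x : α) (hx : x ∈ s \ u) :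
        φ r x ≤ (μ.real (v ∩ s))⁻¹ * rexp (r * (t - t')) := by
      calc φ r x ≤ (μ.real (v ∩ s) * rexp (r * t'))⁻¹ * rexp (r * t) := by
            have := ht x hx
            have := hZ r hr
            dsimp only [φ]
            gcongr
        _ = (μ.real (v ∩ s))⁻¹ * rexp (r * (t - t')) := by
          rw [mul_inv, mul_assoc, ← Real.exp_neg, ← Real.exp_add]
          ring_nf
    have L : Tendsto (fun r : ℝ => (μ.real (v ∩ s))⁻¹ * rexp (r * (t - t'))) atTop (𝓝 0) := by
      have : Tendsto (fun r : ℝ => r * (t - t')) atTop atBot :=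
        tendsto_id.atTop_mul_const_of_neg (sub_neg.2 tt')
      simpa using (tendsto_exp_atBot.comp this).const_mul (μ.real (v ∩ s))⁻¹
    refine Metric.tendstoUniformlyOn_iff.2 fun ε εpos => ?_
    filter_upwards [(tendsto_order.1 L).2 ε εpos, eventually_ge_atTop 0] with r hr hr0 x hx
    simpa [abs_of_nonneg (hφ0 r x)] using (M r hr0 x hx).trans_lt hr
  have key := tendsto_setIntegral_peak_smul_of_integrableOn_of_tendsto hsm hsm subset_rfl
    self_mem_nhdsWithin (measure_ne_top μ s) (Eventually.of_forall fun r x _ => hφ0 r x) A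
    (by simp only [hφ1]; exact tendsto_const_nhds)
    (Eventually.of_forall fun r => ((I r).const_mul _).aestronglyMeasurable) hmg hcg
  simpa only [φ, mul_smul, integral_smul] using key

/-- The gradient of the logarithmic Laplace transform at `η` is the barycenter of the measure with
density proportional to `exp ⟪η, ·⟫`. -/
theorem hasGradientAt_logLaplace {n : ℕ} {μ : Measure (EucSp n)} [IsProbabilityMeasure μ]
    (hμ : IsCompactlySupported μ) (η : EucSp n) :
    HasGradientAt (logLaplace μ)
      ((∫ x, rexp ⟪η, x⟫ ∂μ)⁻¹ • ∫ x, rexp ⟪η, x⟫ • x ∂μ) η := by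
  obtain ⟨R, hR0, hR⟩ : ∃ R : ℝ, 0 < R ∧ ∀ x ∈ msupport μ, ‖x‖ ≤ R :=
    (isCompact_msupport hμ).isBounded.exists_pos_norm_le
  have hae : ∀ᵐ x ∂μ, ‖x‖ ≤ R := (ae_mem_msupport μ).mono hR
  have hexp (ζ x : EucSp n) (hx : ‖x‖ ≤ R) : rexp ⟪ζ, x⟫ ≤ rexp (‖ζ‖ * R) := by
    have := real_inner_le_norm ζ x
    gcongr
    exact this.trans (by gcongr)
  have h_int : Integrable (fun x => rexp ⟪η, x⟫) μ :=
    Integrable.of_bound (by fun_prop) (rexp (‖η‖ * R)) <| hae.mono fun x hx => by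
      simpa using hexp η x hx
  have h_int_smul : Integrable (fun x => rexp ⟪η, x⟫ • x) μ :=
    Integrable.of_bound (by fun_prop) (rexp (‖η‖ * R) * R) <| hae.mono fun x hx => by
      rw [norm_smul, Real.norm_of_nonneg (exp_pos _).le]
      have := hexp η x hx
      gcongr
  have hderiv : HasFDerivAt (fun ζ => ∫ x, rexp ⟪ζ, x⟫ ∂μ)
      (∫ x, rexp ⟪η, x⟫ • innerSL ℝ x ∂μ) η := by
    refine hasFDerivAt_integral_of_dominated_of_fderiv_le
      (F' := fun ζ x => rexp ⟪ζ, x⟫ • innerSL ℝ x)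
      (bound := fun _ => rexp ((‖η‖ + 1) * R) * R) (Metric.ball_mem_nhds η one_pos)
      (Eventually.of_forall fun ζ => by fun_prop) h_int (by fun_prop) ?_ (integrable_const _) ?_
    · filter_upwards [hae] with x hx ζ hζ
      have hζ' : ‖ζ‖ ≤ ‖η‖ + 1 := by
        have := norm_sub_norm_le ζ η
        have := mem_ball_iff_norm.1 hζ
        linarith
      rw [norm_smul, Real.norm_of_nonneg (exp_pos _).le, innerSL_apply_norm]
      have : rexp ⟪ζ, x⟫ ≤ rexp ((‖η‖ + 1) * R) := (hexp ζ x hx).trans (by gcongr)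
      gcongr
    · refine ae_of_all _ fun x ζ _ => ?_
      have h : HasFDerivAt (fun ζ : EucSp n => ⟪ζ, x⟫) (innerSL ℝ x) ζ := by
        simp_rw [real_inner_comm x]
        exact (innerSL ℝ x).hasFDerivAt
      exact h.exp
  have hlog := hderiv.log (integral_exp_pos h_int).ne'
  rw [hasGradientAt_iff_hasFDerivAt]
  refine hlog.congr_fderiv ?_
  rw [map_smul]
  congr 1
  have := (innerSL ℝ (E := EucSp n)).integral_comp_comm h_int_smul
  simp only [map_smul] at this
  exact this

/-- If x₀ is an exposed point of the support of μ, witnessed by ξ (i.e. ξ·x₀ > ξ·x for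
all x ≠ x₀ in the support), then ∇Λ_μ(rξ) → x₀ as r → ∞. -/
theorem gradient_logLaplace_tendsto_exposed_point (n : ℕ) (μ : Measure (EucSp n))
    (hprob : IsProbabilityMeasure μ) (hcpt : IsCompactlySupported μ)
    (hhyp : SuppNotInHyperplane μ) (x₀ : EucSp n) (hx₀ : x₀ ∈ msupport μ)
    (ξ : EucSp n) (hexp : ∀ x ∈ msupport μ, x ≠ x₀ → ⟪ξ, x⟫ < ⟪ξ, x₀⟫) :
    Tendsto (fun r : ℝ => gradient (logLaplace μ) (r • ξ)) atTop (nhds x₀) := by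
  have hcompact := isCompact_msupport hcpt
  have hrestrict : μ.restrict (msupport μ) = μ :=
    Measure.restrict_eq_self_of_ae_mem (ae_mem_msupport μ)
  have hpos : ∀ u, IsOpen u → x₀ ∈ u → 0 < μ (u ∩ msupport μ) := fun u hu hxu => by
    rw [← Measure.restrict_apply hu.measurableSet, hrestrict]
    exact pos_iff_ne_zero.2 (hx₀ u (hu.mem_nhds hxu))
  have key := tendsto_setIntegral_exp_mul_smul_of_unique_maximum hcompact hx₀ hpos
    (f := fun x => ⟪ξ, x⟫) (by fun_prop) hexp (g := fun x => x)
    (continuousOn_id.integrableOn_compact hcompact) continuousWithinAt_id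
  simp_rw [hrestrict] at key
  simpa only [(hasGradientAt_logLaplace hcpt _).gradient, real_inner_smul_left] using key
end
end

section
/- Let μ be a compactly-supported, log-concave probability measure on ℝⁿ. Then for every ξ ∈ ℝⁿ, the gradient of Ψ_μ at ξ, measured in the Riemannian metric given by the Hessian of Λ_μ, satisfies ∇Ψ_μ(ξ) · (∇²Λ_μ(ξ))⁻¹ ∇Ψ_μ(ξ) ≤ n σ̲_n². -/
open MeasureTheory Real Set Filter Topology RealInnerProductSpace Matrix
noncomputable section

/-- A nonnegative function is log-concave. -/
def IsLogConcaveFn {n : ℕ} (f : EucSp n → ℝ) : Prop :=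
  (∀ x, 0 ≤ f x) ∧ ∀ x y : EucSp n, ∀ l : ℝ, l ∈ Set.Icc (0:ℝ) 1 →
    f x ^ (1 - l) * f y ^ l ≤ f ((1 - l) • x + l • y)

/-- A measure is log-concave if it has a log-concave density w.r.t. Lebesgue measure. -/
def IsLogConcave {n : ℕ} (μ : Measure (EucSp n)) : Prop :=
  ∃ f : EucSp n → ℝ, IsLogConcaveFn f ∧
    μ = volume.withDensity (fun x => ENNReal.ofReal (f x))

/-- Barycenter at the origin and covariance matrix equal to the identity. -/
def IsIsotropic {n : ℕ} (μ : Measure (EucSp n)) : Prop :=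
  (∫ x, x ∂μ = 0) ∧ ∀ u v : EucSp n, (∫ x, ⟪x, u⟫ * ⟪x, v⟫ ∂μ) = ⟪u, v⟫

/-- σ_n² = sup over isotropic log-concave random vectors of E (|X| - √n)². -/
def sigmaNSq (n : ℕ) : ℝ :=
  sSup {v | ∃ μ : Measure (EucSp n), IsProbabilityMeasure μ ∧ IsIsotropic μ ∧
    IsLogConcave μ ∧ v = ∫ x, (‖x‖ - Real.sqrt n) ^ 2 ∂μ}

def sigmaN (n : ℕ) : ℝ := Real.sqrt (sigmaNSq n)

/-- σ̲_n = (1/√n) sup over isotropic log-concave random vectors of |E X |X|²|. -/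
def sigmaBar (n : ℕ) : ℝ :=
  (Real.sqrt n)⁻¹ * sSup {v | ∃ μ : Measure (EucSp n), IsProbabilityMeasure μ ∧
    IsIsotropic μ ∧ IsLogConcave μ ∧ v = ‖∫ x, (‖x‖ ^ 2) • x ∂μ‖}

/-- L_n = sup over isotropic log-concave probability densities f on ℝⁿ of f(0)^{1/n}. -/
def LN (n : ℕ) : ℝ :=
  sSup {l | ∃ (μ : Measure (EucSp n)) (f : EucSp n → ℝ),
    IsProbabilityMeasure μ ∧ IsIsotropic μ ∧ IsLogConcaveFn f ∧
    μ = volume.withDensity (fun x => ENNReal.ofReal (f x)) ∧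
    l = f 0 ^ ((n : ℝ)⁻¹)}

open scoped MatrixOrder in
lemma exists_whitening_matrix {n : ℕ} {H : Matrix (Fin n) (Fin n) ℝ} (h : H.PosDef) :
    ∃ A : Matrix (Fin n) (Fin n) ℝ, Aᵀ * A = H⁻¹ ∧ A * H * Aᵀ = 1 ∧ A.det ≠ 0 := by
  obtain ⟨A, hA⟩ := CStarAlgebra.nonneg_iff_eq_star_mul_self.mp h.inv.posSemidef.nonneg
  rw [star_eq_conjTranspose, conjTranspose_eq_transpose_of_trivial] at hA
  have hmul : Aᵀ * (A * H) = 1 := by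
    rw [← mul_assoc, ← hA, Matrix.nonsing_inv_mul _ (isUnit_iff_ne_zero.2 h.det_pos.ne')]
  refine ⟨A, hA.symm, mul_eq_one_comm.1 hmul, fun h0 => ?_⟩
  have := congrArg Matrix.det hmul
  simp [h0] at this

/-- The derivative of the determinant at the identity matrix is the trace. -/
lemma HasFDerivAt.det_of_eq_one {V : Type*} [NormedAddCommGroup V] [NormedSpace ℝ V]
    {ι : Type*} [Fintype ι] [DecidableEq ι] {M : V → Matrix ι ι ℝ} {M' : ι → ι → V →L[ℝ] ℝ} {x : V}
    (h : ∀ i j, HasFDerivAt (fun y => M y i j) (M' i j) x) (hx : M x = 1) :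
    HasFDerivAt (fun y => (M y).det) (∑ i, M' i i) x := by
  have h1 : HasFDerivAt (fun y => ∑ σ : Equiv.Perm ι, ((σ.sign : ℤ) : ℝ) * ∏ i, M y (σ i) i)
      (∑ σ : Equiv.Perm ι, ((σ.sign : ℤ) : ℝ) •
        ∑ i, (∏ j ∈ Finset.univ.erase i, M x (σ j) j) • M' (σ i) i) x :=
    HasFDerivAt.fun_sum fun σ _ => (HasFDerivAt.finsetProd fun i _ => h (σ i) i).const_mul _
  simp_rw [Matrix.det_apply']
  convert! h1 using 1
  rw [Finset.sum_eq_single (1 : Equiv.Perm ι)]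
  · simp [hx]
  · intro σ _ hσ
    rw [Finset.sum_eq_zero, smul_zero]
    intro i _
    obtain ⟨j, hj, hji⟩ : ∃ j, σ j ≠ j ∧ j ≠ i := by
      by_contra! hc
      refine hσ (Equiv.ext fun j => ?_)
      by_contra hj
      have hji := hc j hj
      have := hc (σ j) (fun h => hj (σ.injective h))
      exact hj (this.trans hji.symm)
    rw [Finset.prod_eq_zero (Finset.mem_erase.2 ⟨hji, Finset.mem_univ j⟩), zero_smul]
    rw [hx, Matrix.one_apply_ne hj]
  · simp

lemma IsLogConcaveFn.convex_superlevel {n : ℕ} {f : EucSp n → ℝ} (hf : IsLogConcaveFn f) (c : ℝ) :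
    Convex ℝ {x | c < f x} := by
  rw [convex_iff_forall_pos]
  intro x hx y hy a b ha hb hab
  simp only [Set.mem_ofPred_eq] at *
  have key := hf.2 x y b ⟨hb.le, by linarith⟩
  rw [show 1 - b = a by linarith] at key
  refine lt_of_lt_of_le ?_ key
  rcases lt_or_ge c 0 with hc | hc
  · exact hc.trans_le (mul_nonneg (rpow_nonneg (hf.1 x) _) (rpow_nonneg (hf.1 y) _))
  · calc c = c ^ a * c ^ b := by rw [← rpow_add_of_nonneg hc ha.le hb.le, hab, rpow_one]
      _ < f x ^ a * f y ^ b :=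
        mul_lt_mul'' (rpow_lt_rpow hc hx ha) (rpow_lt_rpow hc hy hb)
          (rpow_nonneg hc _) (rpow_nonneg hc _)

lemma IsLogConcaveFn.aemeasurable {n : ℕ} {f : EucSp n → ℝ} (hf : IsLogConcaveFn f) :
    AEMeasurable f volume := by
  have h : @Measurable (NullMeasurableSpace (EucSp n) volume) ℝ _ _ f :=
    measurable_of_Ioi fun c =>
      (hf.convex_superlevel c).nullMeasurableSet (μ := volume)
  exact NullMeasurable.aemeasurable h

/-- The density at two points is controlled by the density at the two points that trisect the
segment between them. -/
lemma IsLogConcaveFn.mul_le_trisect {n : ℕ} {f : EucSp n → ℝ} (hf : IsLogConcaveFn f)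
    (x y : EucSp n) :
    f x * f y ≤ f ((2 / 3 : ℝ) • x + (1 / 3 : ℝ) • y) * f ((1 / 3 : ℝ) • x + (2 / 3 : ℝ) • y) := by
  have h1 := hf.2 x y (1 / 3) ⟨by norm_num, by norm_num⟩
  have h2 := hf.2 x y (2 / 3) ⟨by norm_num, by norm_num⟩
  rw [show (1 : ℝ) - 1 / 3 = 2 / 3 by norm_num] at h1
  rw [show (1 : ℝ) - 2 / 3 = 1 / 3 by norm_num] at h2
  have split : ∀ t : ℝ, 0 ≤ t → t = t ^ (2 / 3 : ℝ) * t ^ (1 / 3 : ℝ) := fun t ht => by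
    rw [← rpow_add_of_nonneg ht (by norm_num) (by norm_num)]
    norm_num
  calc f x * f y
      = (f x ^ (2 / 3 : ℝ) * f y ^ (1 / 3 : ℝ)) * (f x ^ (1 / 3 : ℝ) * f y ^ (2 / 3 : ℝ)) := by
        conv_lhs => rw [split _ (hf.1 x), split _ (hf.1 y)]
        ring
    _ ≤ _ := mul_le_mul h1 h2
        (mul_nonneg (rpow_nonneg (hf.1 x) _) (rpow_nonneg (hf.1 y) _)) (hf.1 _)

/-- The linear automorphism sending a pair of points to the pair trisecting their segment. -/
def trisect (n : ℕ) : (EucSp n × EucSp n) ≃ₗ[ℝ] (EucSp n × EucSp n) where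
  toFun p := ((2 / 3 : ℝ) • p.1 + (1 / 3 : ℝ) • p.2, (1 / 3 : ℝ) • p.1 + (2 / 3 : ℝ) • p.2)
  invFun q := ((2 : ℝ) • q.1 - q.2, (2 : ℝ) • q.2 - q.1)
  map_add' p q := by ext1 <;> simp only [Prod.fst_add, Prod.snd_add] <;> module
  map_smul' c p := by
    ext1 <;> simp only [Prod.smul_fst, Prod.smul_snd, RingHom.id_apply] <;> module
  left_inv p := by ext1 <;> dsimp only <;> module
  right_inv q := by ext1 <;> dsimp only <;> module

/-- A two-function comparison for log-concave measures, in place of the Prékopa–Leindler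
inequality. -/
lemma IsLogConcave.lintegral_prod_le {n : ℕ} {μ : Measure (EucSp n)} (hlc : IsLogConcave μ)
    {g : EucSp n × EucSp n → ENNReal} (hg : Measurable g) :
    ∫⁻ p, g p ∂(μ.prod μ) ≤
      ENNReal.ofReal |(LinearMap.det (trisect n : EucSp n × EucSp n →ₗ[ℝ] EucSp n × EucSp n))⁻¹| *
        ∫⁻ q, g ((trisect n).symm q) ∂(μ.prod μ) := by
  obtain ⟨f, hf, rfl⟩ := hlc
  set F : EucSp n → ENNReal := fun x => ENNReal.ofReal (f x) with hF
  have hFm : AEMeasurable F volume := hf.aemeasurable.ennreal_ofReal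
  have hFF : AEMeasurable (fun z : EucSp n × EucSp n => F z.1 * F z.2) (volume.prod volume) :=
    (hFm.comp_quasiMeasurePreserving Measure.quasiMeasurePreserving_fst).mul
      (hFm.comp_quasiMeasurePreserving Measure.quasiMeasurePreserving_snd)
  have hsymm : Measurable fun q => (trisect n).symm q :=
    ((trisect n).symm.toContinuousLinearEquiv.continuous).measurable
  have hgs : Measurable fun q => g ((trisect n).symm q) := hg.comp hsymm
  have hemb : MeasurableEmbedding (trisect n) :=
    (trisect n).toContinuousLinearEquiv.toHomeomorph.measurableEmbedding
  have hmap := Measure.map_linearMap_addHaar_eq_smul_addHaar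
    ((volume : Measure (EucSp n)).prod volume) (LinearEquiv.isUnit_det' (trisect n)).ne_zero
  rw [prod_withDensity₀ hFm hFm, lintegral_withDensity_eq_lintegral_mul₀ hFF hg.aemeasurable,
    lintegral_withDensity_eq_lintegral_mul₀ hFF hgs.aemeasurable]
  calc ∫⁻ p, ((fun z : EucSp n × EucSp n => F z.1 * F z.2) * g) p ∂(volume.prod volume)
      ≤ ∫⁻ p, ((fun z : EucSp n × EucSp n => F z.1 * F z.2) *
          fun q => g ((trisect n).symm q)) (trisect n p) ∂(volume.prod volume) := by
        refine lintegral_mono fun p => ?_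
        simp only [Pi.mul_apply, LinearEquiv.symm_apply_apply, hF]
        refine mul_le_mul_left ?_ _
        rw [← ENNReal.ofReal_mul (hf.1 _), ← ENNReal.ofReal_mul (hf.1 _)]
        exact ENNReal.ofReal_le_ofReal (hf.mul_le_trisect _ _)
    _ = ∫⁻ q, ((fun z : EucSp n × EucSp n => F z.1 * F z.2) *
          fun q => g ((trisect n).symm q)) q ∂(Measure.map (trisect n) (volume.prod volume)) := by
        rw [hemb.lintegral_map]
    _ = _ := by
        rw [show Measure.map (trisect n) (volume.prod volume) = _ from hmap, lintegral_smul_measure, smul_eq_mul]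

lemma IsIsotropic.integrable_norm_sq {n : ℕ} {μ : Measure (EucSp n)} (h : IsIsotropic μ) :
    Integrable (fun x => ‖x‖ ^ 2) μ ∧ ∫ x, ‖x‖ ^ 2 ∂μ = n := by
  have hsq : (fun x : EucSp n => ‖x‖ ^ 2) = fun x => ∑ i,
      ⟪x, EuclideanSpace.single i (1 : ℝ)⟫ * ⟪x, EuclideanSpace.single i (1 : ℝ)⟫ := by
    ext x
    rw [EuclideanSpace.real_norm_sq_eq]
    simp [sq, EuclideanSpace.inner_single_right]
  have h1 : ∀ i, ∫ x, ⟪x, EuclideanSpace.single i (1 : ℝ)⟫ *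
      ⟪x, EuclideanSpace.single i (1 : ℝ)⟫ ∂μ = 1 := fun i => by rw [h.2]; simp
  have hi : ∀ i, Integrable (fun x => ⟪x, EuclideanSpace.single i (1 : ℝ)⟫ *
      ⟪x, EuclideanSpace.single i (1 : ℝ)⟫) μ := fun i => by
    by_contra hni
    have := h1 i
    rw [integral_undef hni] at this
    norm_num at this
  rw [hsq]
  refine ⟨integrable_finsetSum _ fun i _ => hi i, ?_⟩
  rw [integral_finsetSum _ fun i _ => hi i, Finset.sum_congr rfl fun i _ => h1 i]
  simp

lemma trisect_symm_norm_bound {n : ℕ} {R : ℝ} (q : EucSp n × EucSp n)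
    (h : ‖((trisect n).symm q).1‖ ^ 2 ≤ R) :
    ‖((trisect n).symm q).2‖ ^ 4 ≤ 324 * (1 + R) ^ 2 * ((1 + ‖q.1‖ ^ 2) * (1 + ‖q.2‖ ^ 2)) := by
  obtain ⟨z, w⟩ := q
  set x := ((trisect n).symm (z, w)).1 with hx
  set y := ((trisect n).symm (z, w)).2 with hy
  have hx' : x = (2 : ℝ) • z - w := rfl
  have hy' : y = (2 : ℝ) • w - z := rfl
  have b1 : ‖y‖ ≤ 3 * ‖z‖ + 2 * ‖x‖ := by
    have : y = (3 : ℝ) • z - (2 : ℝ) • x := by rw [hx', hy']; module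
    rw [this]
    refine (norm_sub_le _ _).trans (le_of_eq ?_)
    rw [norm_smul, norm_smul]; norm_num
  have b2 : ‖y‖ ≤ 3 * ‖w‖ + 2 * ‖x‖ := by
    have : y = (3 / 2 : ℝ) • w - (1 / 2 : ℝ) • x := by rw [hx', hy']; module
    rw [this]
    refine (norm_sub_le _ _).trans ?_
    rw [norm_smul, norm_smul]; norm_num
    linarith [norm_nonneg w, norm_nonneg x]
  have hR : 0 ≤ R := (sq_nonneg _).trans h
  have key : ∀ t : ℝ, 0 ≤ t → ‖y‖ ≤ 3 * t + 2 * ‖x‖ → ‖y‖ ^ 2 ≤ 9 * 2 * (1 + R) * (1 + t ^ 2) := by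
    intro t ht hb
    have : ‖y‖ ^ 2 ≤ (3 * t + 2 * ‖x‖) ^ 2 := by gcongr
    nlinarith [sq_nonneg (3 * t - 2 * ‖x‖), sq_nonneg t, mul_nonneg hR (sq_nonneg t)]
  calc ‖y‖ ^ 4 = ‖y‖ ^ 2 * ‖y‖ ^ 2 := by ring
    _ ≤ (9 * 2 * (1 + R) * (1 + ‖z‖ ^ 2)) * (9 * 2 * (1 + R) * (1 + ‖w‖ ^ 2)) := by
        gcongr
        · exact key _ (norm_nonneg z) b1
        · exact key _ (norm_nonneg w) b2
    _ = _ := by ring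

/-- Isotropic log-concave measures have uniformly bounded fourth moments in each dimension. -/
lemma exists_fourth_moment_bound (n : ℕ) : ∃ C : ENNReal, C ≠ ⊤ ∧ ∀ μ : Measure (EucSp n),
    IsProbabilityMeasure μ → IsIsotropic μ → IsLogConcave μ →
      ∫⁻ x, ENNReal.ofReal (‖x‖ ^ 4) ∂μ ≤ C := by
  set c := ENNReal.ofReal
    |(LinearMap.det (trisect n : EucSp n × EucSp n →ₗ[ℝ] EucSp n × EucSp n))⁻¹|
  set R : ℝ := 2 * (n + 1) with hR
  set D : ENNReal := ENNReal.ofReal (324 * (1 + R) ^ 2)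
  refine ⟨2 * (c * (D * (ENNReal.ofReal (1 + n) * ENNReal.ofReal (1 + n)))), by finiteness, ?_⟩
  intro μ hp hiso hlc
  obtain ⟨hint, hval⟩ := hiso.integrable_norm_sq
  have hR0 : 0 < R := by positivity
  have hm1 : Measurable fun x : EucSp n => ENNReal.ofReal (1 - ‖x‖ ^ 2 / R) := by fun_prop
  have hm2 : Measurable fun x : EucSp n => ENNReal.ofReal (‖x‖ ^ 4) := by fun_prop
  have hm3 : Measurable fun x : EucSp n => ENNReal.ofReal (1 + ‖x‖ ^ 2) := by fun_prop
  have hmain := hlc.lintegral_prod_le (g := fun p => ENNReal.ofReal (1 - ‖p.1‖ ^ 2 / R) *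
    ENNReal.ofReal (‖p.2‖ ^ 4)) (by fun_prop)
  rw [lintegral_prod_mul hm1.aemeasurable hm2.aemeasurable] at hmain
  have hhalf : (2 : ENNReal)⁻¹ ≤ ∫⁻ x, ENNReal.ofReal (1 - ‖x‖ ^ 2 / R) ∂μ := by
    have hi : Integrable (fun x : EucSp n => 1 - ‖x‖ ^ 2 / R) μ :=
      (integrable_const _).sub (hint.div_const _)
    have hmean : ∫ x : EucSp n, 1 - ‖x‖ ^ 2 / R ∂μ = 1 - n / R := by
      rw [integral_sub (integrable_const _) (hint.div_const _), integral_div, hval]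
      simp
    have h2 : (1 / 2 : ℝ) ≤ 1 - n / R := by
      rw [le_sub_comm, div_le_iff₀ hR0, hR]
      linarith
    calc (2 : ENNReal)⁻¹ = ENNReal.ofReal (1 / 2) := by
          rw [ENNReal.ofReal_div_of_pos (by norm_num)]; simp
      _ ≤ ENNReal.ofReal (∫ x : EucSp n, max (1 - ‖x‖ ^ 2 / R) 0 ∂μ) := by
          refine ENNReal.ofReal_le_ofReal (h2.trans (hmean ▸ ?_))
          exact integral_mono hi hi.pos_part fun x => le_max_left _ _
      _ = ∫⁻ x, ENNReal.ofReal (max (1 - ‖x‖ ^ 2 / R) 0) ∂μ :=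
          ofReal_integral_eq_lintegral_ofReal hi.pos_part
            (Eventually.of_forall fun x => le_max_right _ _)
      _ = _ := by simp [ENNReal.ofReal_max]
  have hone : ∫⁻ x : EucSp n, ENNReal.ofReal (1 + ‖x‖ ^ 2) ∂μ = ENNReal.ofReal (1 + n) := by
    have hadd : Integrable (fun x : EucSp n => 1 + ‖x‖ ^ 2) μ := (integrable_const _).add hint
    rw [← ofReal_integral_eq_lintegral_ofReal hadd
      (Eventually.of_forall fun x => by positivity), integral_add (integrable_const _) hint, hval]
    simp
  have hright : ∫⁻ q, ENNReal.ofReal (1 - ‖((trisect n).symm q).1‖ ^ 2 / R) *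
      ENNReal.ofReal (‖((trisect n).symm q).2‖ ^ 4) ∂(μ.prod μ) ≤
      D * (ENNReal.ofReal (1 + n) * ENNReal.ofReal (1 + n)) := by
    rw [← hone, ← lintegral_prod_mul hm3.aemeasurable hm3.aemeasurable,
      ← lintegral_const_mul _ (by fun_prop)]
    refine lintegral_mono fun q => ?_
    dsimp only
    rcases le_or_gt (‖((trisect n).symm q).1‖ ^ 2) R with h | h
    · calc _ ≤ 1 * ENNReal.ofReal (‖((trisect n).symm q).2‖ ^ 4) := by
            gcongr
            rw [ENNReal.ofReal_le_one]
            linarith [show 0 ≤ ‖((trisect n).symm q).1‖ ^ 2 / R by positivity]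
        _ ≤ _ := by
            rw [one_mul, ← ENNReal.ofReal_mul (by positivity), ← ENNReal.ofReal_mul (by positivity)]
            exact ENNReal.ofReal_le_ofReal (trisect_symm_norm_bound q h)
    · have : 1 - ‖((trisect n).symm q).1‖ ^ 2 / R ≤ 0 := by
        rw [sub_nonpos, one_le_div hR0]; exact h.le
      rw [ENNReal.ofReal_of_nonpos this, zero_mul]
      exact zero_le
  calc ∫⁻ x, ENNReal.ofReal (‖x‖ ^ 4) ∂μ
      = 2 * ((2 : ENNReal)⁻¹ * ∫⁻ x, ENNReal.ofReal (‖x‖ ^ 4) ∂μ) := by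
        rw [← mul_assoc, ENNReal.mul_inv_cancel (by norm_num) (by norm_num), one_mul]
    _ ≤ 2 * (c * (D * (ENNReal.ofReal (1 + n) * ENNReal.ofReal (1 + n)))) := by
        refine mul_le_mul_right ?_ _
        exact (mul_le_mul_left hhalf _).trans (hmain.trans (mul_le_mul_right hright _))

lemma bddAbove_norm_third_moment (n : ℕ) :
    BddAbove {v | ∃ μ : Measure (EucSp n), IsProbabilityMeasure μ ∧
      IsIsotropic μ ∧ IsLogConcave μ ∧ v = ‖∫ x, (‖x‖ ^ 2) • x ∂μ‖} := by
  obtain ⟨C, hC, hb⟩ := exists_fourth_moment_bound n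
  refine ⟨(1 + C).toReal, ?_⟩
  rintro v ⟨μ, hp, hiso, hlc, rfl⟩
  rw [← toReal_enorm]
  refine ENNReal.toReal_mono (by finiteness) ((enorm_integral_le_lintegral_enorm _).trans ?_)
  calc ∫⁻ x, ‖(‖x‖ ^ 2) • x‖ₑ ∂μ ≤ ∫⁻ x, (1 + ENNReal.ofReal (‖x‖ ^ 4)) ∂μ := by
        refine lintegral_mono fun x => ?_
        rw [← ofReal_norm, ← ENNReal.ofReal_one,
          ← ENNReal.ofReal_add zero_le_one (by positivity)]
        refine ENNReal.ofReal_le_ofReal ?_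
        rw [norm_smul, norm_pow, norm_norm]
        nlinarith [sq_nonneg (‖x‖ ^ 2 - ‖x‖), sq_nonneg (‖x‖ - 1), sq_nonneg (‖x‖ ^ 2 - 1),
          norm_nonneg x, sq_nonneg (‖x‖ + 1)]
    _ ≤ 1 + C := by
        rw [lintegral_add_left measurable_const]
        simpa using hb μ hp hiso hlc
lemma IsLogConcave.map_add_right {n : ℕ} {μ : Measure (EucSp n)} (h : IsLogConcave μ)
    (b : EucSp n) : IsLogConcave (μ.map fun x => x + b) := by
  obtain ⟨f, hf, rfl⟩ := h
  refine ⟨fun y => f (y - b), ⟨fun x => hf.1 _, fun x y l hl => ?_⟩, ?_⟩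
  · convert hf.2 (x - b) (y - b) l hl using 2
    module
  · have he := (Homeomorph.addRight b).measurableEmbedding
    ext s hs
    rw [show (fun x => x + b) = Homeomorph.addRight b from rfl, he.map_apply,
      withDensity_apply _ (he.measurable hs), withDensity_apply _ hs]
    have hmap : (volume : Measure (EucSp n)).map (Homeomorph.addRight b) = volume :=
      (measurePreserving_add_right volume b).map_eq
    conv_rhs => rw [← hmap]
    rw [he.restrict_map, he.lintegral_map]
    simp

lemma IsLogConcave.map_linearEquiv {n : ℕ} {μ : Measure (EucSp n)} (h : IsLogConcave μ)
    (A : EucSp n ≃ₗ[ℝ] EucSp n) : IsLogConcave (μ.map A) := by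
  obtain ⟨f, hf, rfl⟩ := h
  set d : ℝ := |LinearMap.det (A : EucSp n →ₗ[ℝ] EucSp n)| with hd
  have hdet := (LinearEquiv.isUnit_det' A).ne_zero
  have hd0 : 0 < d := abs_pos.2 hdet
  refine ⟨fun y => d⁻¹ * f (A.symm y), ⟨fun x => by have := hf.1 (A.symm x); positivity,
    fun x y l hl => ?_⟩, ?_⟩
  · have hx := hf.1 (A.symm x)
    have hy := hf.1 (A.symm y)
    have hi : 0 ≤ d⁻¹ := by positivity
    calc (d⁻¹ * f (A.symm x)) ^ (1 - l) * (d⁻¹ * f (A.symm y)) ^ l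
        = (d⁻¹ ^ (1 - l) * d⁻¹ ^ l) * (f (A.symm x) ^ (1 - l) * f (A.symm y) ^ l) := by
          rw [mul_rpow hi hx, mul_rpow hi hy]; ring
      _ = d⁻¹ * (f (A.symm x) ^ (1 - l) * f (A.symm y) ^ l) := by
          rw [← rpow_add (by positivity), sub_add_cancel, rpow_one]
      _ ≤ _ := by
          refine mul_le_mul_of_nonneg_left ?_ hi
          simpa using hf.2 (A.symm x) (A.symm y) l hl
  · have he : MeasurableEmbedding A :=
      A.toContinuousLinearEquiv.toHomeomorph.measurableEmbedding
    have hmap : (volume : Measure (EucSp n)).map A = ENNReal.ofReal d⁻¹ • volume := by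
      simpa [hd, abs_inv] using Measure.map_linearMap_addHaar_eq_smul_addHaar
        (volume : Measure (EucSp n)) hdet
    ext s hs
    rw [he.map_apply, withDensity_apply _ (he.measurable hs), withDensity_apply _ hs]
    simp_rw [ENNReal.ofReal_mul (inv_nonneg.2 hd0.le)]
    rw [lintegral_const_mul' _ _ ENNReal.ofReal_ne_top, ← smul_eq_mul,
      ← lintegral_smul_measure, ← Measure.restrict_smul, ← hmap, he.restrict_map, he.lintegral_map]
    simp

lemma IsLogConcave.tilted {n : ℕ} {μ : Measure (EucSp n)} (h : IsLogConcave μ) (ξ : EucSp n) :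
    IsLogConcave (μ.tilted fun x => ⟪ξ, x⟫) := by
  set Z : ℝ := ∫ x, exp ⟪ξ, x⟫ ∂μ with hZ
  obtain ⟨f, hf, rfl⟩ := h
  have hZ0 : 0 ≤ Z := integral_nonneg fun x => (exp_pos _).le
  refine ⟨fun x => f x * (exp ⟪ξ, x⟫ / Z), ⟨fun x => mul_nonneg (hf.1 x) (by positivity),
    fun x y l hl => ?_⟩, ?_⟩
  · have hx := hf.1 x
    have hy := hf.1 y
    have hexp : exp ⟪ξ, (1 - l) • x + l • y⟫ = exp ⟪ξ, x⟫ ^ (1 - l) * exp ⟪ξ, y⟫ ^ l := by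
      rw [← exp_mul, ← exp_mul, ← exp_add, inner_add_right, inner_smul_right, inner_smul_right]
      ring_nf
    have hZl : Z ^ (1 - l) * Z ^ l = Z := by
      rw [← rpow_add_of_nonneg hZ0 (by linarith [hl.2]) hl.1, sub_add_cancel, rpow_one]
    calc (f x * (exp ⟪ξ, x⟫ / Z)) ^ (1 - l) * (f y * (exp ⟪ξ, y⟫ / Z)) ^ l
        = (f x ^ (1 - l) * f y ^ l) *
          ((exp ⟪ξ, x⟫ ^ (1 - l) * exp ⟪ξ, y⟫ ^ l) / (Z ^ (1 - l) * Z ^ l)) := by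
          rw [mul_rpow hx (by positivity), mul_rpow hy (by positivity),
            div_rpow (exp_pos _).le hZ0, div_rpow (exp_pos _).le hZ0]
          ring
      _ = (f x ^ (1 - l) * f y ^ l) * (exp ⟪ξ, (1 - l) • x + l • y⟫ / Z) := by rw [hZl, hexp]
      _ ≤ _ := by
          exact mul_le_mul_of_nonneg_right (hf.2 x y l hl) (by positivity)
  · have hm : Measurable fun x : EucSp n => ENNReal.ofReal (exp ⟪ξ, x⟫ / Z) := by fun_prop
    rw [Measure.tilted, ← withDensity_mul₀ hf.aemeasurable.ennreal_ofReal hm.aemeasurable]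
    congr 1
    ext x
    rw [ENNReal.ofReal_mul (hf.1 x)]
    rfl

section Calculus

variable {n : ℕ} {μ : Measure (EucSp n)}

lemma IsCompactlySupported.integrable_of_continuous [IsFiniteMeasure μ]
    (h : IsCompactlySupported μ) {G : Type*} [NormedAddCommGroup G]
    {φ : EucSp n → G} (hφ : Continuous φ) : Integrable φ μ := by
  obtain ⟨K, hK, hμK⟩ := h
  have : μ.restrict K = μ := Measure.restrict_eq_self_of_ae_mem (by
    rw [ae_iff]; exact hμK)
  rw [← this]
  exact hφ.continuousOn.integrableOn_compact hK

lemma IsCompactlySupported.tilted (h : IsCompactlySupported μ) (ξ : EucSp n) :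
    IsCompactlySupported (μ.tilted fun x => ⟪ξ, x⟫) := by
  obtain ⟨K, hK, hμK⟩ := h
  exact ⟨K, hK, tilted_absolutelyContinuous _ _ hμK⟩

lemma IsCompactlySupported.isProbabilityMeasure_tilted [IsProbabilityMeasure μ]
    (h : IsCompactlySupported μ) (ξ : EucSp n) :
    IsProbabilityMeasure (μ.tilted fun x => ⟪ξ, x⟫) :=
  MeasureTheory.isProbabilityMeasure_tilted (h.integrable_of_continuous (by fun_prop))

lemma IsCompactlySupported.hasFDerivAt_integral_exp [IsFiniteMeasure μ]
    (h : IsCompactlySupported μ) {φ : EucSp n → ℝ} (hφ : Continuous φ) (ξ : EucSp n) :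
    HasFDerivAt (fun η => ∫ x, φ x * exp ⟪η, x⟫ ∂μ)
      (∫ x, (φ x * exp ⟪ξ, x⟫) • innerSL ℝ x ∂μ) ξ := by
  refine hasFDerivAt_integral_of_dominated_of_fderiv_le
    (F' := fun η x => (φ x * exp ⟪η, x⟫) • innerSL ℝ x)
    (bound := fun x => ‖φ x‖ * exp ((‖ξ‖ + 1) * ‖x‖) * ‖x‖) (Metric.ball_mem_nhds ξ one_pos)
    (Eventually.of_forall fun η => ?_) (h.integrable_of_continuous (by fun_prop)) ?_ ?_
    (h.integrable_of_continuous (by fun_prop)) ?_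
  · exact (show Continuous fun x => φ x * exp ⟪η, x⟫ by fun_prop).aestronglyMeasurable
  · exact (show Continuous fun x => (φ x * exp ⟪ξ, x⟫) • innerSL ℝ x by
      fun_prop).aestronglyMeasurable
  · refine Eventually.of_forall fun x η hη => ?_
    rw [norm_smul, norm_mul, innerSL_apply_norm, norm_of_nonneg (exp_pos _).le]
    gcongr
    refine (real_inner_le_norm _ _).trans ?_
    gcongr
    have := norm_sub_norm_le η ξ
    rw [Metric.mem_ball, dist_eq_norm] at hη
    linarith
  · refine Eventually.of_forall fun x η _ => ?_
    have h1 : HasFDerivAt (fun η : EucSp n => ⟪η, x⟫) (innerSL ℝ x) η := by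
      convert! (innerSL ℝ x).hasFDerivAt (x := η) using 2 with y
      exact real_inner_comm _ _
    convert! h1.exp.const_mul (φ x) using 1
    rw [smul_smul]

lemma integral_tilted_inner (φ : EucSp n → ℝ) (ξ : EucSp n) :
    ∫ x, φ x ∂(μ.tilted fun x => ⟪ξ, x⟫) =
      (∫ x, φ x * exp ⟪ξ, x⟫ ∂μ) * (∫ x, exp ⟪ξ, x⟫ ∂μ)⁻¹ := by
  rw [integral_tilted, ← integral_mul_const]
  congr 1 with x
  rw [smul_eq_mul]
  ring

/-- Derivative of the expectation of `φ` under the exponentially tilted measure. -/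
lemma IsCompactlySupported.hasFDerivAt_integral_tilted [IsProbabilityMeasure μ]
    (h : IsCompactlySupported μ) {φ : EucSp n → ℝ} (hφ : Continuous φ) (ξ : EucSp n) :
    HasFDerivAt (fun η => ∫ x, φ x ∂(μ.tilted fun x => ⟪η, x⟫))
      (∫ x, φ x • innerSL ℝ (x - ∫ y, y ∂(μ.tilted fun x => ⟪ξ, x⟫))
        ∂(μ.tilted fun x => ⟪ξ, x⟫)) ξ := by
  have hP := h.isProbabilityMeasure_tilted ξ
  have hcP := h.tilted ξ
  have hZ : 0 < ∫ x, exp ⟪ξ, x⟫ ∂μ :=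
    integral_exp_pos (h.integrable_of_continuous (by fun_prop))
  have h1 : HasFDerivAt (fun η => ∫ x, exp ⟪η, x⟫ ∂μ)
      (∫ x, (exp ⟪ξ, x⟫) • innerSL ℝ x ∂μ) ξ := by
    simpa using h.hasFDerivAt_integral_exp (φ := fun _ => 1) continuous_const ξ
  simp_rw [integral_tilted_inner]
  convert! (h.hasFDerivAt_integral_exp hφ ξ).mul
    ((hasDerivAt_inv hZ.ne').comp_hasFDerivAt ξ h1) using 1
  ext v
  have hb : ⟪∫ y, y ∂(μ.tilted fun x => ⟪ξ, x⟫), v⟫ = ∫ y, ⟪y, v⟫ ∂(μ.tilted fun x => ⟪ξ, x⟫) := by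
    simp_rw [real_inner_comm v]
    exact (integral_inner (hcP.integrable_of_continuous continuous_id) v).symm
  have hl : (∫ x, φ x • innerSL ℝ (x - ∫ y, y ∂(μ.tilted fun x => ⟪ξ, x⟫))
        ∂(μ.tilted fun x => ⟪ξ, x⟫)) v =
      (∫ x, φ x * ⟪x, v⟫ ∂(μ.tilted fun x => ⟪ξ, x⟫)) -
        (∫ x, φ x ∂(μ.tilted fun x => ⟪ξ, x⟫)) * ∫ y, ⟪y, v⟫ ∂(μ.tilted fun x => ⟪ξ, x⟫) := by
    rw [ContinuousLinearMap.integral_apply (hcP.integrable_of_continuous (by fun_prop)),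
      ← hb, ← integral_mul_const, ← integral_sub (hcP.integrable_of_continuous (by fun_prop))
        (hcP.integrable_of_continuous (by fun_prop))]
    congr 1 with x
    simp only [_root_.smul_apply, innerSL_apply_apply, inner_sub_left, smul_eq_mul]
    ring
  have hr1 : (∫ x, (φ x * exp ⟪ξ, x⟫) • innerSL ℝ x ∂μ) v = ∫ x, φ x * ⟪x, v⟫ * exp ⟪ξ, x⟫ ∂μ := by
    rw [ContinuousLinearMap.integral_apply (h.integrable_of_continuous (by fun_prop))]
    congr 1 with x
    simp only [_root_.smul_apply, innerSL_apply_apply, smul_eq_mul]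
    ring
  have hr2 : (∫ x, exp ⟪ξ, x⟫ • innerSL ℝ x ∂μ) v = ∫ x, ⟪x, v⟫ * exp ⟪ξ, x⟫ ∂μ := by
    rw [ContinuousLinearMap.integral_apply (h.integrable_of_continuous (by fun_prop))]
    congr 1 with x
    simp only [_root_.smul_apply, innerSL_apply_apply, smul_eq_mul]
    ring
  rw [hl]
  simp only [integral_tilted_inner, _root_.add_apply, _root_.smul_apply,
    hr1, hr2, smul_eq_mul, Function.comp_apply]
  field_simp
  ring

lemma IsCompactlySupported.hasFDerivAt_logLaplace [IsProbabilityMeasure μ]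
    (h : IsCompactlySupported μ) (ξ : EucSp n) :
    HasFDerivAt (logLaplace μ) (innerSL ℝ (∫ y, y ∂(μ.tilted fun x => ⟪ξ, x⟫))) ξ := by
  have hZ : 0 < ∫ x, exp ⟪ξ, x⟫ ∂μ :=
    integral_exp_pos (h.integrable_of_continuous (by fun_prop))
  have h1 : HasFDerivAt (fun η => ∫ x, exp ⟪η, x⟫ ∂μ)
      (∫ x, (exp ⟪ξ, x⟫) • innerSL ℝ x ∂μ) ξ := by
    simpa using h.hasFDerivAt_integral_exp (φ := fun _ => 1) continuous_const ξ
  convert! h1.log hZ.ne' using 1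
  have hi : Integrable (fun x => (exp ⟪ξ, x⟫ / ∫ x, exp ⟪ξ, x⟫ ∂μ) • x) μ :=
    h.integrable_of_continuous (by fun_prop)
  rw [integral_tilted, ← (innerSL ℝ).integral_comp_comm hi, ← integral_smul]
  congr 1 with x
  simp only [map_smul, smul_smul]
  ring_nf

lemma IsCompactlySupported.clm_integral_id [IsFiniteMeasure μ] (h : IsCompactlySupported μ)
    {G : Type*} [NormedAddCommGroup G] [NormedSpace ℝ G] [CompleteSpace G]
    (ℓ : EucSp n →L[ℝ] G) : ∫ x, ℓ x ∂μ = ℓ (∫ x, x ∂μ) :=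
  ℓ.integral_comp_comm (h.integrable_of_continuous continuous_id)

lemma IsCompactlySupported.integral_centered [IsProbabilityMeasure μ] (h : IsCompactlySupported μ)
    {G : Type*} [NormedAddCommGroup G] [NormedSpace ℝ G] [CompleteSpace G]
    (ℓ : EucSp n →L[ℝ] G) : ∫ x, ℓ (x - ∫ y, y ∂μ) ∂μ = 0 := by
  simp_rw [map_sub]
  rw [integral_sub (h.integrable_of_continuous (by fun_prop)) (integrable_const _),
    h.clm_integral_id]
  simp

lemma IsCompactlySupported.integral_cov [IsProbabilityMeasure μ] (h : IsCompactlySupported μ)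
    (ℓ m : EucSp n →L[ℝ] ℝ) :
    ∫ x, ℓ (x - ∫ y, y ∂μ) * m (x - ∫ y, y ∂μ) ∂μ =
      (∫ x, ℓ x * m x ∂μ) - (∫ x, ℓ x ∂μ) * ∫ x, m x ∂μ := by
  set b := ∫ y, y ∂μ with hb
  have h1 : ∀ x, ℓ (x - b) * m (x - b) = ℓ x * m x - (ℓ b * m x + m b * ℓ (x - b)) := fun x => by
    simp only [map_sub]; ring
  simp_rw [h1]
  rw [integral_sub (h.integrable_of_continuous (by fun_prop))
      (h.integrable_of_continuous (by fun_prop)),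
    integral_add (h.integrable_of_continuous (by fun_prop))
      (h.integrable_of_continuous (by fun_prop)), integral_const_mul, integral_const_mul,
    h.integral_centered, h.clm_integral_id ℓ, h.clm_integral_id m, ← hb]
  ring

/-- Derivative of the covariance of two linear functionals under exponential tilting: it is given
by third central moments. -/
lemma IsCompactlySupported.hasFDerivAt_cov [IsProbabilityMeasure μ]
    (h : IsCompactlySupported μ) (ℓ m : EucSp n →L[ℝ] ℝ) (ξ : EucSp n) :
    HasFDerivAt (fun η => ∫ x, ℓ (x - ∫ y, y ∂(μ.tilted fun x => ⟪η, x⟫)) *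
        m (x - ∫ y, y ∂(μ.tilted fun x => ⟪η, x⟫)) ∂(μ.tilted fun x => ⟪η, x⟫))
      (∫ x, (ℓ (x - ∫ y, y ∂(μ.tilted fun x => ⟪ξ, x⟫)) *
        m (x - ∫ y, y ∂(μ.tilted fun x => ⟪ξ, x⟫))) •
        innerSL ℝ (x - ∫ y, y ∂(μ.tilted fun x => ⟪ξ, x⟫)) ∂(μ.tilted fun x => ⟪ξ, x⟫)) ξ := by
  have hP := fun η => h.isProbabilityMeasure_tilted η
  have hfun := funext fun η => (h.tilted η).integral_cov ℓ m
  rw [hfun]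
  convert! (h.hasFDerivAt_integral_tilted (φ := fun x => ℓ x * m x) (by fun_prop) ξ).sub
    ((h.hasFDerivAt_integral_tilted ℓ.continuous ξ).mul
      (h.hasFDerivAt_integral_tilted m.continuous ξ)) using 1
  have hc := h.tilted ξ
  set P := μ.tilted fun x => ⟪ξ, x⟫
  rw [hc.clm_integral_id, hc.clm_integral_id]
  have hz := hc.integral_centered (innerSL ℝ)
  set b := ∫ y, y ∂P
  rw [← integral_smul, ← integral_smul, ← integral_add (hc.integrable_of_continuous (by fun_prop))
      (hc.integrable_of_continuous (by fun_prop)),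
    ← integral_sub (hc.integrable_of_continuous (by fun_prop))
      (hc.integrable_of_continuous (by fun_prop)), ← sub_eq_zero,
    ← integral_sub (hc.integrable_of_continuous (by fun_prop))
      (hc.integrable_of_continuous (by fun_prop))]
  rw [← smul_zero (ℓ b * m b), ← hz, ← integral_smul]
  congr 1 with x : 1
  rw [map_sub ℓ, map_sub m]
  module

lemma IsCompactlySupported.hessianM_logLaplace_apply [IsProbabilityMeasure μ]
    (h : IsCompactlySupported μ) (ξ : EucSp n) (i j : Fin n) :
    hessianM (logLaplace μ) ξ i j =
      ∫ x, (x - ∫ y, y ∂(μ.tilted fun x => ⟪ξ, x⟫)) i *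
        (x - ∫ y, y ∂(μ.tilted fun x => ⟪ξ, x⟫)) j ∂(μ.tilted fun x => ⟪ξ, x⟫) := by
  have hP := fun η => h.isProbabilityMeasure_tilted η
  have hc := h.tilted ξ
  have hfun : (fun η => fderiv ℝ (logLaplace μ) η (EuclideanSpace.single j 1)) =
      fun η => ∫ x, x j ∂(μ.tilted fun x => ⟪η, x⟫) := by
    ext η
    rw [(h.hasFDerivAt_logLaplace η).fderiv]
    simpa [EuclideanSpace.inner_single_right] using
      ((h.tilted η).clm_integral_id (EuclideanSpace.proj j)).symm
  rw [hessianM, Matrix.of_apply, hfun,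
    (h.hasFDerivAt_integral_tilted (φ := fun x => x j) (by fun_prop) ξ).fderiv,
    ContinuousLinearMap.integral_apply (hc.integrable_of_continuous (by fun_prop))]
  simp only [_root_.smul_apply, innerSL_apply_apply, EuclideanSpace.inner_single_right, smul_eq_mul,
    one_mul, conj_trivial]
  have hz := hc.integral_centered (EuclideanSpace.proj (𝕜 := ℝ) i)
  simp only [PiLp.proj_apply] at hz
  set P := μ.tilted fun x => ⟪ξ, x⟫
  set b := ∫ y, y ∂P
  have h2 : ∀ x : EucSp n, x j * (x - b) i = (x - b) i * (x - b) j + b j * (x - b) i := fun x => by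
    simp only [PiLp.sub_apply]; ring
  simp_rw [h2]
  rw [integral_add (hc.integrable_of_continuous (by fun_prop))
    (hc.integrable_of_continuous (by fun_prop)), integral_const_mul, hz, mul_zero, add_zero]

lemma IsCompactlySupported.dotProduct_hessianM_mulVec [IsProbabilityMeasure μ]
    (h : IsCompactlySupported μ) (ξ : EucSp n) (u w : Fin n → ℝ) :
    u ⬝ᵥ (hessianM (logLaplace μ) ξ *ᵥ w) =
      ∫ x, (u ⬝ᵥ (x - ∫ y, y ∂(μ.tilted fun x => ⟪ξ, x⟫)).ofLp) *
        (w ⬝ᵥ (x - ∫ y, y ∂(μ.tilted fun x => ⟪ξ, x⟫)).ofLp) ∂(μ.tilted fun x => ⟪ξ, x⟫) := by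
  have hP := h.isProbabilityMeasure_tilted ξ
  have hc := h.tilted ξ
  simp only [dotProduct, Matrix.mulVec, h.hessianM_logLaplace_apply, Finset.sum_mul_sum]
  rw [integral_finsetSum _ fun i _ => hc.integrable_of_continuous (by fun_prop)]
  refine Finset.sum_congr rfl fun i _ => ?_
  rw [integral_finsetSum _ fun j _ => hc.integrable_of_continuous (by fun_prop), Finset.mul_sum]
  refine Finset.sum_congr rfl fun j _ => ?_
  rw [← integral_mul_const, ← integral_const_mul]
  congr 1 with x
  ring

lemma IsCompactlySupported.posDef_hessianM_logLaplace [IsProbabilityMeasure μ]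
    (h : IsCompactlySupported μ) (hlc : IsLogConcave μ) (ξ : EucSp n) :
    (hessianM (logLaplace μ) ξ).PosDef := by
  have hP := h.isProbabilityMeasure_tilted ξ
  have hc := h.tilted ξ
  refine .of_dotProduct_mulVec_pos ?_ fun u hu => ?_
  · ext i j
    simp only [Matrix.conjTranspose_apply, star_trivial, h.hessianM_logLaplace_apply]
    simp_rw [mul_comm]
  · rw [star_trivial, h.dotProduct_hessianM_mulVec]
    set P := μ.tilted fun x => ⟪ξ, x⟫ with hPdef
    set b := ∫ y, y ∂P
    set ψ : EucSp n → ℝ := fun x => u ⬝ᵥ (x - b).ofLp with hψ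
    have hcont : Continuous ψ := by
      simp only [hψ, dotProduct]
      fun_prop
    rw [integral_pos_iff_support_of_nonneg (fun x => mul_self_nonneg _)
      (hc.integrable_of_continuous (hcont.mul hcont)), pos_iff_ne_zero]
    intro h0
    set ℓ : EucSp n →ₗ[ℝ] ℝ := innerₛₗ ℝ (WithLp.toLp 2 u : EucSp n) with hℓ
    have hval : ∀ x, ψ x = ℓ x - ℓ b := fun x => by
      rw [← map_sub]
      simp [hψ, hℓ, PiLp.inner_apply, dotProduct, mul_comm]
    set S : AffineSubspace ℝ (EucSp n) := AffineSubspace.mk' b (LinearMap.ker ℓ) with hS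
    have hmem : ∀ x, x ∈ S ↔ ψ x = 0 := fun x => by
      rw [hS, AffineSubspace.mem_mk', LinearMap.mem_ker, vsub_eq_sub, map_sub, hval]
    have hSne : S ≠ ⊤ := by
      intro htop
      have h1 : b + WithLp.toLp 2 u ∈ S := htop ▸ AffineSubspace.mem_top ℝ _ _
      rw [hmem, hval, map_add, add_sub_cancel_left] at h1
      have h2 : WithLp.toLp 2 u = (0 : EucSp n) := by
        simpa [hℓ] using h1
      exact hu (by simpa using congrArg WithLp.ofLp h2)
    have hvol := Measure.addHaar_affineSubspace (volume : Measure (EucSp n)) S hSne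
    have hac : P ≪ volume := by
      obtain ⟨f, -, hf⟩ := hlc.tilted ξ
      rw [hPdef, hf]
      exact withDensity_absolutelyContinuous _ _
    have hone : P Set.univ ≤ 0 := by
      calc P Set.univ ≤ P (S ∪ Function.support fun x => ψ x * ψ x) := by
            refine measure_mono fun x _ => ?_
            by_cases hx : ψ x = 0
            · exact Or.inl ((hmem x).2 hx)
            · exact Or.inr (mul_self_ne_zero.2 hx)
        _ ≤ P S + P (Function.support fun x => ψ x * ψ x) := measure_union_le _ _
        _ = 0 := by rw [hac hvol, h0, add_zero]
    rw [measure_univ] at hone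
    exact absurd hone (by simp)

end Calculus

section Whitening

variable {n : ℕ} {μ : Measure (EucSp n)}

lemma exists_linearEquiv_of_det_ne_zero {A : Matrix (Fin n) (Fin n) ℝ} (hA : A.det ≠ 0) :
    ∃ e : EucSp n ≃ₗ[ℝ] EucSp n, ∀ x, (e x).ofLp = A *ᵥ x.ofLp := by
  have := A.invertibleOfIsUnitDet (isUnit_iff_ne_zero.2 hA)
  exact ⟨(WithLp.linearEquiv 2 ℝ (Fin n → ℝ)).trans
    ((A.toLinearEquiv' this).trans (WithLp.linearEquiv 2 ℝ (Fin n → ℝ)).symm), fun x => rfl⟩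

lemma inner_eq_dotProduct_ofLp (x y : EucSp n) : ⟪x, y⟫ = x.ofLp ⬝ᵥ y.ofLp := by
  simp [PiLp.inner_apply, dotProduct, mul_comm]

/-- The gradient of `Ψ_μ` at `ξ`, in terms of a linear map `e` (with matrix `A`) whitening the
tilted measure. -/
lemma IsCompactlySupported.hasGradientAt_PsiFn [IsProbabilityMeasure μ]
    (h : IsCompactlySupported μ) (hlc : IsLogConcave μ) (ξ : EucSp n)
    {A : Matrix (Fin n) (Fin n) ℝ} (hA : A * hessianM (logLaplace μ) ξ * Aᵀ = 1)
    (hdet : A.det ≠ 0) {e : EucSp n ≃ₗ[ℝ] EucSp n} (he : ∀ x, (e x).ofLp = A *ᵥ x.ofLp) :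
    HasGradientAt (PsiFn μ) (∫ x, (‖e (x - ∫ y, y ∂(μ.tilted fun x => ⟪ξ, x⟫))‖ ^ 2) •
      (x - ∫ y, y ∂(μ.tilted fun x => ⟪ξ, x⟫)) ∂(μ.tilted fun x => ⟪ξ, x⟫)) ξ := by
  have hcomp : ∀ i (x : EucSp n), innerSL ℝ (WithLp.toLp 2 (A i)) x = e x i := fun i x => by
    rw [innerSL_apply_apply, inner_eq_dotProduct_ofLp, he]
    rfl
  have hentry : ∀ η i j, (A * hessianM (logLaplace μ) η * Aᵀ) i j =
      ∫ x, innerSL ℝ (WithLp.toLp 2 (A i)) (x - ∫ y, y ∂(μ.tilted fun x => ⟪η, x⟫)) *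
        innerSL ℝ (WithLp.toLp 2 (A j)) (x - ∫ y, y ∂(μ.tilted fun x => ⟪η, x⟫))
          ∂(μ.tilted fun x => ⟪η, x⟫) := fun η i j => by
    have hdot : ∀ k (x : EucSp n), innerSL ℝ (WithLp.toLp 2 (A k)) x = A k ⬝ᵥ x.ofLp :=
      fun k x => inner_eq_dotProduct_ofLp _ _
    simp only [hdot]
    rw [← h.dotProduct_hessianM_mulVec, Matrix.mul_assoc]
    simp only [Matrix.mul_apply, dotProduct, Matrix.mulVec, Matrix.transpose_apply]
  have hD := HasFDerivAt.det_of_eq_one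
    (M := fun η => A * hessianM (logLaplace μ) η * Aᵀ) (x := ξ) (fun i j => by
      simp_rw [hentry]
      exact h.hasFDerivAt_cov _ _ ξ) hA
  have h0 := (h.posDef_hessianM_logLaplace hlc 0).det_pos.ne'
  have hPsi : PsiFn μ = fun η => log ((A * hessianM (logLaplace μ) η * Aᵀ).det *
      (A.det ^ 2 * (hessianM (logLaplace μ) 0).det)⁻¹) := by
    ext η
    rw [PsiFn, Matrix.det_mul, Matrix.det_mul, Matrix.det_transpose]
    congr 1
    field_simp
  have hc : (A.det ^ 2 * (hessianM (logLaplace μ) 0).det)⁻¹ ≠ 0 := by positivity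
  rw [hasGradientAt_iff_hasFDerivAt, hPsi]
  have hc1 := h.tilted ξ
  have hP := h.isProbabilityMeasure_tilted ξ
  have hL := (hD.mul_const (A.det ^ 2 * (hessianM (logLaplace μ) 0).det)⁻¹).log (by
    simpa [hA] using hc)
  convert! hL using 1
  simp only [hA, Matrix.det_one, one_mul, inv_smul_smul₀ hc]
  have hecont : Continuous e := e.toContinuousLinearEquiv.continuous
  rw [← integral_finsetSum _ fun i _ => hc1.integrable_of_continuous (by fun_prop)]
  set b := ∫ y, y ∂(μ.tilted fun x => ⟪ξ, x⟫)
  have hint : Integrable (fun x => ‖e (x - b)‖ ^ 2 • (x - b)) (μ.tilted fun x => ⟪ξ, x⟫) :=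
    hc1.integrable_of_continuous (by fun_prop)
  change innerSL ℝ _ = _
  rw [← (innerSL ℝ).integral_comp_comm hint]
  congr 1 with x : 1
  rw [map_smul, ← Finset.sum_smul, EuclideanSpace.norm_sq_eq]
  simp only [hcomp, norm_eq_abs, pow_two, abs_mul_abs_self]

/-- The whitened tilted measure is isotropic and log-concave, so its third moment vector is
bounded in terms of the supremum over all such measures. -/
lemma IsCompactlySupported.norm_whitened_third_moment_le [IsProbabilityMeasure μ]
    (h : IsCompactlySupported μ) (hlc : IsLogConcave μ) (ξ : EucSp n)
    {A : Matrix (Fin n) (Fin n) ℝ} (hA : A * hessianM (logLaplace μ) ξ * Aᵀ = 1)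
    {e : EucSp n ≃ₗ[ℝ] EucSp n} (he : ∀ x, (e x).ofLp = A *ᵥ x.ofLp) :
    ‖e (∫ x, (‖e (x - ∫ y, y ∂(μ.tilted fun x => ⟪ξ, x⟫))‖ ^ 2) •
      (x - ∫ y, y ∂(μ.tilted fun x => ⟪ξ, x⟫)) ∂(μ.tilted fun x => ⟪ξ, x⟫))‖ ≤
    sSup {v | ∃ μ : Measure (EucSp n), IsProbabilityMeasure μ ∧
      IsIsotropic μ ∧ IsLogConcave μ ∧ v = ‖∫ x, (‖x‖ ^ 2) • x ∂μ‖} := by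
  have hP := h.isProbabilityMeasure_tilted ξ
  have hc := h.tilted ξ
  have hquad := h.dotProduct_hessianM_mulVec ξ
  set P := μ.tilted fun x => ⟪ξ, x⟫ with hPdef
  set b := ∫ y, y ∂P with hb
  set E : EucSp n ≃L[ℝ] EucSp n := e.toContinuousLinearEquiv
  have hEe : ∀ x, E x = e x := fun x => rfl
  have hecont : Continuous e := E.continuous
  set T : EucSp n ≃ₜ EucSp n := (Homeomorph.addRight (-b)).trans E.toHomeomorph with hT
  have hTx : ∀ x, T x = e (x - b) := fun x => by rw [sub_eq_add_neg]; rfl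
  have hmap : P.map T = (P.map fun x => x + -b).map e := by
    rw [Measure.map_map hecont.measurable (by fun_prop)]
    rfl
  have hint : ∀ {G : Type} [NormedAddCommGroup G] [NormedSpace ℝ G] (φ : EucSp n → G),
      ∫ y, φ y ∂(P.map T) = ∫ x, φ (e (x - b)) ∂P := fun φ => by
    rw [T.measurableEmbedding.integral_map]
    simp_rw [hTx]
  refine le_csSup (bddAbove_norm_third_moment n) ⟨P.map T,
    Measure.isProbabilityMeasure_map T.continuous.aemeasurable, ⟨?_, fun u v => ?_⟩, ?_, ?_⟩
  · rw [hint]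
    exact hc.integral_centered (E : EucSp n →L[ℝ] EucSp n)
  · rw [hint]
    have hdot : ∀ x w, ⟪e x, w⟫ = (Aᵀ *ᵥ w.ofLp) ⬝ᵥ x.ofLp := fun x w => by
      rw [inner_eq_dotProduct_ofLp, he, Matrix.mulVec_transpose, ← Matrix.dotProduct_mulVec,
        dotProduct_comm]
    simp_rw [hdot]
    rw [← hquad, Matrix.mulVec_mulVec, Matrix.mulVec_transpose, ← Matrix.dotProduct_mulVec,
      Matrix.mulVec_mulVec, ← Matrix.mul_assoc, hA, Matrix.one_mulVec, inner_eq_dotProduct_ofLp]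
  · rw [hmap]
    exact ((hlc.tilted ξ).map_add_right (-b)).map_linearEquiv e
  · rw [hint, ← hEe, ← E.integral_comp_comm]
    simp_rw [map_smul]
    rfl

end Whitening

/-- For a compactly-supported log-concave probability measure μ on ℝⁿ and any ξ ∈ ℝⁿ,
the gradient of Ψ_μ at ξ, measured in the Riemannian metric given by the Hessian of Λ_μ,
satisfies ∇Ψ_μ(ξ) · (∇²Λ_μ(ξ))⁻¹ ∇Ψ_μ(ξ) ≤ n σ̲_n². -/
theorem riemannian_norm_gradient_Psi_le (n : ℕ) (μ : Measure (EucSp n))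
    (hprob : IsProbabilityMeasure μ) (hcpt : IsCompactlySupported μ)
    (hlc : IsLogConcave μ) :
    ∀ ξ : EucSp n,
      (gradient (PsiFn μ) ξ : EucSp n) ⬝ᵥ
          ((hessianM (logLaplace μ) ξ)⁻¹).mulVec (gradient (PsiFn μ) ξ : EucSp n) ≤
        (n : ℝ) * sigmaBar n ^ 2 := by
  intro ξ
  obtain ⟨A, hAH, hA, hdet⟩ := exists_whitening_matrix (hcpt.posDef_hessianM_logLaplace hlc ξ)
  obtain ⟨e, he⟩ := exists_linearEquiv_of_det_ne_zero hdet
  rw [(hcpt.hasGradientAt_PsiFn hlc ξ hA hdet he).gradient]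
  have hle := hcpt.norm_whitened_third_moment_le hlc ξ hA he
  set g := ∫ x, (‖e (x - ∫ y, y ∂(μ.tilted fun x => ⟪ξ, x⟫))‖ ^ 2) •
      (x - ∫ y, y ∂(μ.tilted fun x => ⟪ξ, x⟫)) ∂(μ.tilted fun x => ⟪ξ, x⟫)
  have hquad : g.ofLp ⬝ᵥ (hessianM (logLaplace μ) ξ)⁻¹ *ᵥ g.ofLp = ‖e g‖ ^ 2 := by
    rw [← real_inner_self_eq_norm_sq, inner_eq_dotProduct_ofLp, he, ← hAH, ← Matrix.mulVec_mulVec,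
      Matrix.dotProduct_mulVec, Matrix.vecMul_transpose]
  rcases Nat.eq_zero_or_pos n with rfl | hn
  · simp [dotProduct]
  rw [hquad, sigmaBar, mul_pow, inv_pow, sq_sqrt n.cast_nonneg,
    mul_inv_cancel_left₀ (by positivity)]
  gcongr
end
end
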